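/- arXiv:2605.15884 — 4 statements merged into one kernel-verified Lean document; each statement's English description precedes it below -/
import Mathlib

section
/- Let R be the unicyclic generator on n ≥ 3 states with rates k⁺ᵢ > 0 and k⁻ᵢ > 0, finite cycle affinity F ≥ 0 and maximum escape rate r. Let λ be a nonreal eigenvalue of R with left eigenvector u and winding number w = ω(u). Then |Im λ|/(2r + Re λ) ≤ F/(π(n − 2w)). -/
open Matrix Finset

/-- Wrapped frequency `|k|ₙ := min (k mod n) ((n - k) mod n)`. -/
def wrapIdx (n : ℕ) (k : ℤ) : ℤ :=
  min (k % (n : ℤ)) (((n : ℤ) - k) % (n : ℤ))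

/-- Winding number `ω(u)` of a vector `u` around the unicycle:
`|(1/2π) ∑ᵢ Arg (u_{i+1}/uᵢ)|ₙ` (the sum divided by `2π` is an integer
whenever `u` is an eigenvector with all components nonzero). -/
noncomputable def windingNum (n : ℕ) [NeZero n] (u : ZMod n → ℂ) : ℤ :=
  wrapIdx n (round ((∑ i : ZMod n, Complex.arg (u (i + 1) / u i)) / (2 * Real.pi)))

/-- The unicyclic generator on `n` states with forward rates `kp` and backward
rates `km`, viewed as a complex matrix: `R j i = kpᵢ` if `j = i+1`, `kmᵢ` if
`j = i-1`, `-(kpᵢ+kmᵢ)` if `j = i`, and `0` otherwise. -/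
noncomputable def uniGenC (n : ℕ) [NeZero n] (kp km : ZMod n → ℝ) :
    Matrix (ZMod n) (ZMod n) ℂ :=
  Matrix.of fun j i =>
    if j = i + 1 then (kp i : ℂ)
    else if j = i - 1 then (km i : ℂ)
    else if j = i then -((kp i : ℂ) + (km i : ℂ))
    else 0

/-- `T = tanh (F / 2n)` where `F = ∑ᵢ ln (kpᵢ/kmᵢ)` is the cycle affinity;
`T = 1` when the affinity is infinite (some `kmᵢ = 0`). -/
noncomputable def uniT (n : ℕ) [NeZero n] (kp km : ZMod n → ℝ) : ℝ :=
  open Classical in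
  if ∀ i, km i ≠ 0 then
    Real.tanh ((∑ i : ZMod n, Real.log (kp i / km i)) / (2 * n))
  else 1

/-- A property on `ZMod n` that propagates along `i - 1 ↦ i` and holds somewhere holds everywhere. -/
lemma ZMod.forall_of_pred_step {n : ℕ} [NeZero n] {P : ZMod n → Prop}
    (step : ∀ i, P (i - 1) → P i) {j : ZMod n} (hj : P j) (i : ZMod n) : P i := by
  have h : ∀ m : ℕ, P (j + m) := by
    intro m
    induction m with
    | zero => simpa using hj
    | succ m ih =>
      apply step
      have : j + ((m + 1 : ℕ) : ZMod n) - 1 = j + m := by push_cast; ring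
      rwa [this]
  simpa using h (i - j).val

lemma ZMod.sum_add_one {n : ℕ} [NeZero n] (f : ZMod n → ℝ) :
    ∑ i, f (i + 1) = ∑ i, f i :=
  Equiv.sum_comp (Equiv.addRight (1 : ZMod n)) f

lemma ZMod.sum_sub_one {n : ℕ} [NeZero n] (f : ZMod n → ℝ) :
    ∑ i, f (i - 1) = ∑ i, f i :=
  Equiv.sum_comp (Equiv.subRight (1 : ZMod n)) f

lemma Complex.arg_mem_Ioo_of_im_pos {w : ℂ} (hw : 0 < w.im) :
    w.arg ∈ Set.Ioo 0 Real.pi :=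
  ⟨lt_of_le_of_ne (Complex.arg_nonneg_iff.2 hw.le) fun h =>
    hw.ne' (Complex.arg_eq_zero_iff.1 h.symm).2, Complex.arg_lt_pi_iff.2 (Or.inr hw.ne')⟩

lemma Real.arctan_div_eq_pi_div_two_sub_arg {w : ℂ} (hw : 0 < w.im) :
    Real.arctan (w.re / w.im) = Real.pi / 2 - Complex.arg w := by
  obtain ⟨h0, h1⟩ := Complex.arg_mem_Ioo_of_im_pos hw
  apply Real.arctan_eq_of_tan_eq
  · rw [Real.tan_pi_div_two_sub, Complex.tan_arg, inv_div]
  · constructor <;> linarith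

/-- The two base angles of the triangle with vertices `0`, `1`, `-z` add up to `arg z`. -/
lemma Complex.arctan_add_arctan_eq_pi_sub_arg {z : ℂ} (hz : 0 < z.im) :
    Real.arctan ((1 + z.re) / z.im) + Real.arctan ((Complex.normSq z + z.re) / z.im)
      = Real.pi - Complex.arg z := by
  have hz0 : z ≠ 0 := fun h => by simp [h] at hz
  have h1 : (0 : ℝ) < (1 + z).im := by simpa using hz
  have h10 : 1 + z ≠ 0 := fun h => by simp [h] at h1
  have e : (Complex.normSq z : ℂ) + z = z * (starRingEnd ℂ) (1 + z) := by
    rw [map_add, map_one, mul_add, mul_one, Complex.mul_conj, add_comm]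
  have h2 : (0 : ℝ) < ((Complex.normSq z : ℂ) + z).im := by simpa using hz
  have b1 := Complex.arg_mem_Ioo_of_im_pos h1
  have bz := Complex.arg_mem_Ioo_of_im_pos hz
  have hc : ((starRingEnd ℂ) (1 + z)).arg = - (1 + z).arg := by
    rw [Complex.arg_conj, if_neg b1.2.ne]
  have ea := Real.arctan_div_eq_pi_div_two_sub_arg h1
  have eb := Real.arctan_div_eq_pi_div_two_sub_arg h2
  rw [e, Complex.arg_mul hz0 ((map_ne_zero _).2 h10)
    (by rw [hc]; constructor <;> linarith [b1.1, b1.2, bz.1, bz.2]), hc, ← e] at eb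
  simp only [Complex.add_re, Complex.add_im, Complex.one_re, Complex.one_im, Complex.ofReal_re,
    Complex.ofReal_im, zero_add] at ea eb
  rw [ea, eb]
  ring

lemma monotoneOn_mul_log_add_log_sub_arctan {D : ℝ} (hD : 0 < D) :
    MonotoneOn (fun t : ℝ => D * Real.log (D + t) + 1 / (2 * D) * Real.log (1 + t ^ 2)
      - Real.arctan t) (Set.Ioi (-D)) := by
  have key : ∀ t ∈ Set.Ioi (-D), HasDerivAt (fun t : ℝ => D * Real.log (D + t)
      + 1 / (2 * D) * Real.log (1 + t ^ 2) - Real.arctan t)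
      (D * (1 / (D + t)) + 1 / (2 * D) * (2 * t / (1 + t ^ 2)) - 1 / (1 + t ^ 2)) t := by
    intro t ht
    have ht' : 0 < D + t := by simp only [Set.mem_Ioi] at ht; linarith
    have h1 := (((hasDerivAt_id t).const_add D).log ht'.ne').const_mul D
    have h2 : HasDerivAt (fun t : ℝ => 1 + t ^ 2) (2 * t) t := by
      simpa using ((hasDerivAt_id t).pow 2).const_add 1
    have h3 := (h2.log (by positivity)).const_mul (1 / (2 * D))
    exact (h1.add h3).sub (Real.hasDerivAt_arctan t)
  apply monotoneOn_of_deriv_nonneg (convex_Ioi _)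
  · exact fun t ht => (key t ht).continuousAt.continuousWithinAt
  · rw [interior_Ioi]
    exact fun t ht => (key t ht).differentiableAt.differentiableWithinAt
  · rw [interior_Ioi]
    intro t ht
    rw [(key t ht).deriv]
    have ht' : 0 < D + t := by simp only [Set.mem_Ioi] at ht; linarith
    have : D * (1 / (D + t)) + 1 / (2 * D) * (2 * t / (1 + t ^ 2)) - 1 / (1 + t ^ 2)
        = (D ^ 2 + 1) * t ^ 2 / (D * (D + t) * (1 + t ^ 2)) := by
      have : 1 + t ^ 2 ≠ 0 := by positivity
      field_simp
      ring
    rw [this]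
    positivity

lemma wrapIdx_neg (n : ℕ) (k : ℤ) : wrapIdx n (-k) = wrapIdx n k := by
  unfold wrapIdx
  rw [min_comm]
  congr 1
  · rw [sub_neg_eq_add, Int.add_emod_left]
  · rw [sub_eq_add_neg, Int.add_emod_left]

lemma wrapIdx_of_nonneg {n : ℕ} {k : ℤ} (h0 : 0 < k) (h1 : 2 * k < n) : wrapIdx n k = k := by
  unfold wrapIdx
  rw [Int.emod_eq_of_lt h0.le (by omega), Int.emod_eq_of_lt (by omega) (by omega)]
  omega

/-- The total argument around a closed cycle of nonzero complex numbers is in `2πℤ`. -/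
lemma exists_int_sum_arg_div_eq {n : ℕ} [NeZero n] {u : ZMod n → ℂ} (hu : ∀ i, u i ≠ 0) :
    ∃ k : ℤ, ∑ i, Complex.arg (u (i + 1) / u i) = k * (2 * Real.pi) := by
  have h : (((∑ i, Complex.arg (u (i + 1) / u i) : ℝ)) : Real.Angle) = 0 := by
    rw [← Real.Angle.coe_coeHom, map_sum]
    simp only [Real.Angle.coe_coeHom]
    simp only [Complex.arg_div_coe_angle (hu _) (hu _), Finset.sum_sub_distrib]
    rw [sub_eq_zero]
    exact Equiv.sum_comp (Equiv.addRight (1 : ZMod n)) fun i => ((u i).arg : Real.Angle)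
  obtain ⟨k, hk⟩ := Real.Angle.coe_eq_zero_iff.1 h
  exact ⟨k, by rw [← hk, zsmul_eq_mul]⟩

/-- If every `u (i + 1) / u i` is in the open upper half-plane, the winding number is not wrapped. -/
lemma windingNum_mul_two_pi {n : ℕ} [NeZero n] {u : ZMod n → ℂ} (hu : ∀ i, u i ≠ 0)
    (him : ∀ i, 0 < (u (i + 1) / u i).im) :
    (windingNum n u : ℝ) * (2 * Real.pi) = ∑ i, Complex.arg (u (i + 1) / u i) ∧
      2 * windingNum n u < n := by
  obtain ⟨k, hk⟩ := exists_int_sum_arg_div_eq hu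
  have hpi := Real.pi_pos
  have h0 : 0 < ∑ i, Complex.arg (u (i + 1) / u i) :=
    Finset.sum_pos (fun i _ => (Complex.arg_mem_Ioo_of_im_pos (him i)).1) Finset.univ_nonempty
  have h1 : ∑ i, Complex.arg (u (i + 1) / u i) < ∑ _i : ZMod n, Real.pi :=
    Finset.sum_lt_sum_of_nonempty Finset.univ_nonempty fun i _ =>
      (Complex.arg_mem_Ioo_of_im_pos (him i)).2
  simp only [Finset.sum_const, Finset.card_univ, ZMod.card, nsmul_eq_mul] at h1
  rw [hk] at h0 h1
  have k0 : 0 < k := by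
    have : (0 : ℝ) < k := by
      by_contra! h
      nlinarith
    exact_mod_cast this
  have k1 : 2 * k < n := by
    have : (2 * k : ℝ) < n := by
      by_contra! h
      nlinarith
    exact_mod_cast this
  have hw : windingNum n u = k := by
    unfold windingNum
    rw [hk, mul_div_cancel_right₀ _ (by positivity), round_intCast, wrapIdx_of_nonneg k0 k1]
  rw [hw]
  exact ⟨hk.symm, k1⟩

lemma windingNum_conj {n : ℕ} [NeZero n] {u : ZMod n → ℂ}
    (him : ∀ i, (u (i + 1) / u i).im ≠ 0) (hu : ∀ i, u i ≠ 0) :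
    windingNum n (fun i => (starRingEnd ℂ) (u i)) = windingNum n u := by
  obtain ⟨k, hk⟩ := exists_int_sum_arg_div_eq hu
  have hc : ∑ i, Complex.arg ((starRingEnd ℂ) (u (i + 1)) / (starRingEnd ℂ) (u i))
      = ((-k : ℤ) : ℝ) * (2 * Real.pi) := by
    push_cast
    rw [neg_mul, ← hk, ← Finset.sum_neg_distrib]
    refine Finset.sum_congr rfl fun i _ => ?_
    rw [← map_div₀, Complex.arg_conj, if_neg]
    exact (Complex.arg_lt_pi_iff.2 (Or.inr (him i))).ne
  have h2 : (2 * Real.pi) ≠ 0 := by positivity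
  unfold windingNum
  rw [hk, hc, mul_div_cancel_right₀ _ h2, mul_div_cancel_right₀ _ h2, round_intCast,
    round_intCast, wrapIdx_neg]

lemma uniGenC_transpose_mulVec {n : ℕ} [NeZero n] (hn : 3 ≤ n) (kp km : ZMod n → ℝ)
    (u : ZMod n → ℂ) (i : ZMod n) :
    ((uniGenC n kp km)ᵀ *ᵥ u) i =
      kp i * (u (i + 1) - u i) + km i * (u (i - 1) - u i) := by
  have h1 : (1 : ZMod n) ≠ 0 := by
    intro h
    have := (ZMod.natCast_eq_zero_iff 1 n).1 (by simpa using h)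
    have := Nat.le_of_dvd one_pos this
    omega
  have h2 : (2 : ZMod n) ≠ 0 := by
    intro h
    have := (ZMod.natCast_eq_zero_iff 2 n).1 (by simpa using h)
    have := Nat.le_of_dvd two_pos this
    omega
  have ha : i - 1 ≠ i + 1 := fun h => h2 (by linear_combination -h)
  have hb : i ≠ i + 1 := fun h => h1 (by linear_combination -h)
  have hc : i ≠ i - 1 := fun h => h1 (by linear_combination h)
  have hsum : ∀ j, (uniGenC n kp km)ᵀ i j * u j =
      (if j = i + 1 then (kp i : ℂ) * u j else 0) + (if j = i - 1 then (km i : ℂ) * u j else 0)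
        + (if j = i then -((kp i : ℂ) + km i) * u j else 0) := by
    intro j
    simp only [uniGenC, Matrix.transpose_apply, Matrix.of_apply]
    by_cases e1 : j = i + 1
    · subst e1
      simp [ha.symm, hb.symm]
    · by_cases e2 : j = i - 1
      · subst e2
        simp [ha, hc.symm]
      · by_cases e3 : j = i
        · subst e3
          simp [hb, hc]
        · simp [e1, e2, e3]
  simp only [Matrix.mulVec, dotProduct, hsum, Finset.sum_add_distrib, Finset.sum_ite_eq',
    Finset.mem_univ, if_true]
  ring

/-- Along a left eigenvector whose eigenvalue has positive imaginary part, the quadratic form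
`Im (conj (u i) * u (i + 1))` is positive on every edge. -/
lemma edge_im_pos {n : ℕ} [NeZero n] {kp km : ZMod n → ℝ} (hkp : ∀ i, 0 < kp i)
    (hkm : ∀ i, 0 < km i) (hF : 0 ≤ ∑ i, Real.log (kp i / km i)) {w : ℝ} (hw : 0 < w)
    {J N : ZMod n → ℝ} (hN : ∀ i, 0 ≤ N i) (hN0 : ∃ i, N i ≠ 0)
    (hz : ∀ i, N i = 0 → J i = 0)
    (hJ : ∀ i, kp i * J i - km i * J (i - 1) = w * N i) (i : ZMod n) : 0 < J i := by
  have stepge : ∀ i, 0 < J (i - 1) → 0 < J i := by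
    intro i h
    have h1 := mul_pos (hkm i) h
    have h2 := mul_nonneg hw.le (hN i)
    have h3 : 0 < kp i * J i := by linarith [hJ i]
    exact pos_of_mul_pos_right h3 (hkp i).le
  by_contra hi
  have hneg : ∀ j, J j ≤ 0 := by
    by_contra! h
    obtain ⟨j, hj⟩ := h
    exact hi (ZMod.forall_of_pred_step (P := fun i => 0 < J i) stepge hj i)
  have stepz : ∀ i, J (i - 1) = 0 → J i = 0 := by
    intro i h
    have h1 := mul_nonneg hw.le (hN i)
    have h2 := hJ i
    rw [h, mul_zero, sub_zero] at h2
    have h3 : 0 ≤ kp i * J i := by linarith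
    exact le_antisymm (hneg i) (nonneg_of_mul_nonneg_right h3 (hkp i))
  have hlt : ∀ j, J j < 0 := by
    intro j
    refine lt_of_le_of_ne (hneg j) fun h => ?_
    have hall := ZMod.forall_of_pred_step (P := fun i => J i = 0) stepz h
    obtain ⟨k, hk⟩ := hN0
    have := hJ k
    rw [hall k, hall (k - 1), mul_zero, mul_zero, sub_zero] at this
    exact hk ((mul_eq_zero.1 this.symm).resolve_left hw.ne')
  have hNpos : ∀ i, 0 < N i := fun i =>
    lt_of_le_of_ne (hN i) fun h => (hlt i).ne (hz i h.symm)
  have hlog : ∀ i, Real.log (kp i / km i) < Real.log (-J (i - 1)) - Real.log (-J i) := by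
    intro i
    have a1 : 0 < -J i := neg_pos.2 (hlt i)
    have a2 : 0 < -J (i - 1) := neg_pos.2 (hlt _)
    rw [← Real.log_div a2.ne' a1.ne']
    apply Real.log_lt_log (div_pos (hkp i) (hkm i))
    rw [div_lt_div_iff₀ (hkm i) a1]
    nlinarith [hJ i, mul_pos hw (hNpos i)]
  have := Finset.sum_lt_sum_of_nonempty (Finset.univ_nonempty (α := ZMod n)) fun i _ => hlog i
  rw [Finset.sum_sub_distrib, ZMod.sum_sub_one fun i => Real.log (-J i)] at this
  linarith

/-- Real form of the affinity bound. Here `N i = |u i|²`, and `C i`, `J i` are the real and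
imaginary part of `conj (u i) * u (i + 1)`. -/
lemma sum_arctan_le_mul_affinity {n : ℕ} [NeZero n] {kp km : ZMod n → ℝ} (hkp : ∀ i, 0 < kp i)
    (hkm : ∀ i, 0 < km i) {w D : ℝ} (hw : 0 < w) {N C J : ZMod n → ℝ} (hN : ∀ i, 0 < N i)
    (hJ : ∀ i, 0 < J i) (hCJ : ∀ i, C i ^ 2 + J i ^ 2 = N i * N (i + 1))
    (him : ∀ i, kp i * J i - km i * J (i - 1) = w * N i)
    (hre : ∀ i, kp i * (N i + C i) + km i * (N i + C (i - 1)) ≤ D * (w * N i)) :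
    0 < D ∧ ∑ i, (Real.arctan ((N i + C i) / J i) + Real.arctan ((N (i + 1) + C i) / J i))
      ≤ D * ∑ i, Real.log (kp i / km i) := by
  set a : ZMod n → ℝ := fun i => (N i + C i) / J i with ha
  set b : ZMod n → ℝ := fun i => (N (i + 1) + C i) / J i with hb
  have haJ : ∀ i, a i * J i = N i + C i := fun i => div_mul_cancel₀ _ (hJ i).ne'
  have hbJ : ∀ i, b i * J i = N (i + 1) + C i := fun i => div_mul_cancel₀ _ (hJ i).ne'
  have hbJ' : ∀ i, b (i - 1) * J (i - 1) = N i + C (i - 1) := fun i => by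
    simpa using hbJ (i - 1)
  have hS : ∀ i, 0 < N i + 2 * C i + N (i + 1) := by
    intro i
    have h1 := hCJ i
    have h2 := pow_pos (hJ i) 2
    have h3 := hN i
    have h4 := hN (i + 1)
    by_contra! h
    nlinarith [sq_nonneg (N i - N (i + 1))]
  have hab : ∀ i, -a i < b i := by
    intro i
    have : 0 < (a i + b i) * J i := by rw [add_mul, haJ, hbJ]; linarith [hS i]
    linarith [pos_of_mul_pos_left this (hJ i).le]
  have hx : ∀ i, 0 < kp i * J i := fun i => mul_pos (hkp i) (hJ i)
  have hy : ∀ i, 0 < km i * J (i - 1) := fun i => mul_pos (hkm i) (hJ _)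
  have hxy : ∀ i, km i * J (i - 1) < kp i * J i := fun i => by
    linarith [him i, mul_pos hw (hN i)]
  have hmain : ∀ i, km i * J (i - 1) * (D + b (i - 1)) ≤ kp i * J i * (D - a i) := by
    intro i
    have h := hre i
    rw [← haJ, ← hbJ', ← him] at h
    linarith
  have hDb : ∀ i, 0 < D + b i := by
    have hstep : ∀ i, 0 ≤ D + b (i - 1) → 0 < D + b i := fun i h => by
      have := nonneg_of_mul_nonneg_right ((mul_nonneg (hy i).le h).trans (hmain i)) (hx i)
      linarith [hab i]
    by_cases hex : ∃ j, 0 ≤ D + b j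
    · obtain ⟨j, hj⟩ := hex
      intro i
      exact hstep i (ZMod.forall_of_pred_step (P := fun i => 0 ≤ D + b i)
        (fun i h => (hstep i h).le) hj _)
    · push Not at hex
      exfalso
      have hlt : ∀ i, b (i - 1) < b i := by
        intro i
        nlinarith [hmain i, hex (i - 1), hxy i, hab i, hx i]
      have := Finset.sum_lt_sum_of_nonempty (Finset.univ_nonempty (α := ZMod n)) fun i _ => hlt i
      rw [ZMod.sum_sub_one] at this
      exact this.false
  have hDa : ∀ i, 0 < D - a i := fun i =>
    pos_of_mul_pos_right ((mul_pos (hy i) (hDb _)).trans_le (hmain i)) (hx i).le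
  have hD : 0 < D := by
    by_contra! hD
    have hlt : ∀ i, N i < N (i + 1) := by
      intro i
      have h1 : a i < b i := by linarith [hDa i, hDb i]
      have h2 := mul_lt_mul_of_pos_right h1 (hJ i)
      rw [haJ, hbJ] at h2
      linarith
    have := Finset.sum_lt_sum_of_nonempty (Finset.univ_nonempty (α := ZMod n)) fun i _ => hlt i
    rw [ZMod.sum_add_one] at this
    exact this.false
  refine ⟨hD, ?_⟩
  have hlocal : ∀ i, Real.arctan (a i) + Real.arctan (b i) ≤
      D * (Real.log (D + b i) - Real.log (D - a i))
        + 1 / (2 * D) * (Real.log (N (i + 1)) - Real.log (N i)) := by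
    intro i
    have h := monotoneOn_mul_log_add_log_sub_arctan hD
      (a := -a i) (b := b i) (by simp only [Set.mem_Ioi]; linarith [hDa i])
      (by simp only [Set.mem_Ioi]; linarith [hDb i]) (hab i).le
    have e1 : Real.log (1 + (b i) ^ 2) =
        Real.log (N (i + 1)) + Real.log ((N i + 2 * C i + N (i + 1)) / J i ^ 2) := by
      rw [← Real.log_mul (hN _).ne' (div_pos (hS i) (pow_pos (hJ i) 2)).ne']
      congr 1
      have := (hJ i).ne'
      simp only [hb]
      field_simp
      linear_combination hCJ i
    have e2 : Real.log (1 + (-a i) ^ 2) =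
        Real.log (N i) + Real.log ((N i + 2 * C i + N (i + 1)) / J i ^ 2) := by
      rw [← Real.log_mul (hN _).ne' (div_pos (hS i) (pow_pos (hJ i) 2)).ne']
      congr 1
      have := (hJ i).ne'
      simp only [ha]
      field_simp
      linear_combination hCJ i
    simp only [e1, e2, Real.arctan_neg, ← sub_eq_add_neg] at h
    linarith
  have hlog : ∀ i, Real.log (D + b (i - 1)) - Real.log (D - a i) ≤
      Real.log (kp i / km i) + (Real.log (J i) - Real.log (J (i - 1))) := by
    intro i
    have h := Real.log_le_log (mul_pos (hy i) (hDb _)) (hmain i)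
    rw [Real.log_mul (hy i).ne' (hDb _).ne', Real.log_mul (hx i).ne' (hDa i).ne',
      Real.log_mul (hkm i).ne' (hJ _).ne', Real.log_mul (hkp i).ne' (hJ i).ne'] at h
    rw [Real.log_div (hkp i).ne' (hkm i).ne']
    linarith
  have s1 := Finset.sum_le_sum fun i (_ : i ∈ Finset.univ) => hlocal i
  have s2 := Finset.sum_le_sum fun i (_ : i ∈ Finset.univ) => hlog i
  simp only [Finset.sum_add_distrib, ← Finset.mul_sum, Finset.sum_sub_distrib] at s1 s2 ⊢
  rw [ZMod.sum_sub_one fun i => Real.log (D + b i), ZMod.sum_sub_one fun i => Real.log (J i),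
    sub_self, add_zero] at s2
  rw [ZMod.sum_add_one fun i => Real.log (N i), sub_self, mul_zero, add_zero] at s1
  exact s1.trans (mul_le_mul_of_nonneg_left s2 hD.le)

/-- The bound for an eigenvalue with positive imaginary part, together with the fact that all
component ratios of the eigenvector lie in the open upper half-plane. -/
lemma bound_of_im_pos {n : ℕ} [NeZero n] {kp km : ZMod n → ℝ} (hkp : ∀ i, 0 < kp i)
    (hkm : ∀ i, 0 < km i) (hF : 0 ≤ ∑ i, Real.log (kp i / km i)) {r : ℝ}
    (hr : ∀ i, kp i + km i ≤ r) {lam : ℂ} (hlam : 0 < lam.im) {u : ZMod n → ℂ} (hu : u ≠ 0)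
    (heig : ∀ i, kp i * (u (i + 1) - u i) + km i * (u (i - 1) - u i) = lam * u i) :
    (∀ i, u i ≠ 0) ∧ (∀ i, 0 < (u (i + 1) / u i).im) ∧
    lam.im / (2 * r + lam.re) ≤ (∑ i, Real.log (kp i / km i)) /
      (Real.pi * ((n : ℝ) - 2 * (windingNum n u : ℝ))) := by
  set N : ZMod n → ℝ := fun i => Complex.normSq (u i) with hNdef
  set C : ZMod n → ℝ := fun i => (u i).re * (u (i + 1)).re + (u i).im * (u (i + 1)).im with hCdef
  set J : ZMod n → ℝ := fun i => (u i).re * (u (i + 1)).im - (u i).im * (u (i + 1)).re with hJdef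
  have hEre : ∀ i, kp i * ((u (i + 1)).re - (u i).re) + km i * ((u (i - 1)).re - (u i).re)
      = lam.re * (u i).re - lam.im * (u i).im := fun i => by
    simpa using congrArg Complex.re (heig i)
  have hEim : ∀ i, kp i * ((u (i + 1)).im - (u i).im) + km i * ((u (i - 1)).im - (u i).im)
      = lam.re * (u i).im + lam.im * (u i).re := fun i => by
    simpa using congrArg Complex.im (heig i)
  have him : ∀ i, kp i * J i - km i * J (i - 1) = lam.im * N i := by
    intro i
    simp only [hJdef, hNdef, sub_add_cancel, Complex.normSq_apply]
    linear_combination (u i).re * hEim i - (u i).im * hEre i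
  have hreq : ∀ i, kp i * C i + km i * C (i - 1) = (lam.re + (kp i + km i)) * N i := by
    intro i
    simp only [hCdef, hNdef, sub_add_cancel, Complex.normSq_apply]
    linear_combination (u i).re * hEre i + (u i).im * hEim i
  have hJ : ∀ i, 0 < J i := by
    refine edge_im_pos hkp hkm hF hlam (N := N) (fun i => Complex.normSq_nonneg _) ?_ ?_ him
    · by_contra! h
      exact hu (funext fun i => Complex.normSq_eq_zero.1 (h i))
    · intro i h
      have : u i = 0 := Complex.normSq_eq_zero.1 h
      simp [hJdef, this]
  have hu0 : ∀ i, u i ≠ 0 := fun i h => by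
    have := hJ i
    simp [hJdef, h] at this
  have hN : ∀ i, 0 < N i := fun i => Complex.normSq_pos.2 (hu0 i)
  have zim : ∀ i, (u (i + 1) / u i).im = J i / N i := fun i => by
    rw [Complex.div_im]; simp only [hJdef, hNdef]; ring
  have zre : ∀ i, (u (i + 1) / u i).re = C i / N i := fun i => by
    rw [Complex.div_re]; simp only [hCdef, hNdef]; ring
  have zpos : ∀ i, 0 < (u (i + 1) / u i).im := fun i => by
    rw [zim]; exact div_pos (hJ i) (hN i)
  refine ⟨hu0, zpos, ?_⟩
  obtain ⟨hD, hsum⟩ := sum_arctan_le_mul_affinity (C := C) (D := (2 * r + lam.re) / lam.im)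
    hkp hkm hlam hN hJ (fun i => by
      simp only [hCdef, hJdef, hNdef, Complex.normSq_apply]; ring) him (fun i => by
      rw [← mul_assoc, div_mul_cancel₀ _ hlam.ne']
      nlinarith [hreq i, mul_le_mul_of_nonneg_right (hr i) (hN i).le])
  have hang : ∀ i, Real.arctan ((N i + C i) / J i) + Real.arctan ((N (i + 1) + C i) / J i)
      = Real.pi - Complex.arg (u (i + 1) / u i) := by
    intro i
    rw [← Complex.arctan_add_arctan_eq_pi_sub_arg (zpos i), zim, zre, Complex.normSq_div]
    have := (hN i).ne'
    have := (hJ i).ne'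
    change _ = Real.arctan ((1 + C i / N i) / (J i / N i))
      + Real.arctan ((N (i + 1) / N i + C i / N i) / (J i / N i))
    congr 2 <;> field_simp
  obtain ⟨hW, hWlt⟩ := windingNum_mul_two_pi hu0 zpos
  simp only [hang, Finset.sum_sub_distrib, Finset.sum_const, Finset.card_univ, ZMod.card,
    nsmul_eq_mul, ← hW] at hsum
  have hWlt' : (2 * windingNum n u : ℝ) < n := by exact_mod_cast hWlt
  have hden : 0 < Real.pi * ((n : ℝ) - 2 * (windingNum n u : ℝ)) :=
    mul_pos Real.pi_pos (by linarith)
  have hD' : 0 < 2 * r + lam.re := by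
    simpa [div_mul_cancel₀ _ hlam.ne'] using mul_pos hD hlam
  rw [div_le_div_iff₀ hD' hden]
  rw [div_mul_eq_mul_div, le_div_iff₀ hlam] at hsum
  linarith

theorem unicyclic_size_independent_dual
    (n : ℕ) [NeZero n] (hn : 3 ≤ n)
    (kp km : ZMod n → ℝ) (hkp : ∀ i, 0 < kp i) (hkm : ∀ i, 0 < km i)
    (hF : 0 ≤ ∑ i : ZMod n, Real.log (kp i / km i))
    (r : ℝ) (hr : IsGreatest (Set.range fun i : ZMod n => kp i + km i) r)
    (lam : ℂ) (hlam : lam.im ≠ 0)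
    (u : ZMod n → ℂ) (hu : u ≠ 0)
    (heig : (uniGenC n kp km)ᵀ *ᵥ u = lam • u) :
    |lam.im| / (2 * r + lam.re) ≤
      (∑ i : ZMod n, Real.log (kp i / km i)) /
        (Real.pi * ((n : ℝ) - 2 * (windingNum n u : ℝ))) := by
  have hr' : ∀ i, kp i + km i ≤ r := fun i => hr.2 ⟨i, rfl⟩
  have he : ∀ i, kp i * (u (i + 1) - u i) + km i * (u (i - 1) - u i) = lam * u i := fun i => by
    rw [← uniGenC_transpose_mulVec hn, heig, Pi.smul_apply, smul_eq_mul]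
  rcases lt_or_gt_of_ne hlam with h | h
  · obtain ⟨h0, hpos, hle⟩ := bound_of_im_pos hkp hkm hF hr'
      (lam := (starRingEnd ℂ) lam) (by simpa using h)
      (u := fun i => (starRingEnd ℂ) (u i))
      (fun h0 => hu (funext fun i => by simpa using congrFun h0 i))
      (fun i => by simpa using congrArg (starRingEnd ℂ) (he i))
    rw [windingNum_conj (fun i hi => ?_) fun i hi => h0 i (by simp [hi])] at hle
    · simpa [abs_of_neg h] using hle
    · have := hpos i
      rw [← map_div₀, Complex.conj_im, hi] at this
      simp at this
  · rw [abs_of_pos h]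
    exact (bound_of_im_pos hkp hkm hF hr' h hu he).2.2
end

section
/- Let V be a nonempty finite set, E ⊆ V × V a set of directed edges containing no self-loops, and f : V × V → ℝ an edge-weight function. Assume: (1) for every vertex i ∈ V, the total outgoing weight Σ_{j : (j←i)∈E} f(j←i) is nonnegative; (2) every vertex i ∈ V has at least one outgoing edge (j←i) ∈ E; (3) whenever (j←i) ∈ E with f(j←i) ≥ 0 and the reverse edge (i←j) ∈ E, then f(i←j) < 0. Then there exists a directed simple cycle c (a cyclically ordered sequence of at least two distinct vertices of V, each consecutive pair joined by an edge of E) such that either (A) every edge (j←i) of c has f(j←i) ≥ 0 and at least one edge (j←i) of c is irreversible, i.e. (i←j) ∉ E, or (B) every edge (j←i) of c has f(j←i) > 0 and (i←j) ∈ E, and Σ_{(j←i)∈c} ln( f(j←i)/(−f(i←j)) ) ≥ 0. -/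
open Finset

/-- The total weight of the consecutive pairs of a list. -/
def pathWeight {V : Type*} (w : V → V → ℝ) : List V → ℝ
  | [] => 0
  | [_] => 0
  | a :: b :: l => w a b + pathWeight w (b :: l)

theorem pathWeight_append_cons {V : Type*} (w : V → V → ℝ) (a : List V) (i : V) (b : List V) :
    pathWeight w (a ++ i :: b) = pathWeight w (a ++ [i]) + pathWeight w (i :: b) := by
  induction a with
  | nil => simp [pathWeight]
  | cons x a ih =>
    cases a with
    | nil => simp [pathWeight]
    | cons y a =>
      simp only [List.cons_append, pathWeight] at ih ⊢
      rw [ih]; ring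

theorem pathWeight_ofFn {V : Type*} (w : V → V → ℝ) (n : ℕ) (g : Fin (n + 1) → V) :
    pathWeight w (List.ofFn g) = ∑ t : Fin n, w (g t.castSucc) (g t.succ) := by
  induction n with
  | zero => simp [pathWeight]
  | succ n ih =>
    have h := ih (fun t => g t.succ)
    rw [Fin.sum_univ_succ, List.ofFn_succ, List.ofFn_succ, pathWeight]
    rw [List.ofFn_succ] at h
    rw [h]
    simp

theorem exists_cycle_of_list {V : Type*} (R : V → V → Prop) (w : V → V → ℝ)
    (a : List V) (i j : V) (hnd : (j :: (a ++ [i])).Nodup)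
    (hch : (j :: (a ++ [i])).IsChain R) (hR : R i j) :
    ∃ (m : ℕ) (c : ZMod (m + 2) → V), Function.Injective c ∧
      (∀ t, R (c t) (c (t + 1))) ∧
      ∑ t, w (c t) (c (t + 1)) = pathWeight w (j :: (a ++ [i])) + w i j := by
  obtain ⟨g, hg⟩ : ∃ g : Fin (a.length + 2) → V, List.ofFn g = j :: (a ++ [i]) := by
    have hlen : (j :: (a ++ [i])).length = a.length + 2 := by simp
    refine ⟨fun t => (j :: (a ++ [i])).get (t.cast hlen.symm), ?_⟩
    apply List.ext_get
    · simp
    · intros; simp [-List.ofFn_succ]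
  have h0 : g 0 = j := by
    have := congrArg (fun l => l[0]?) hg
    simpa using this
  have hl : g (Fin.last _) = i := by
    have := congrArg (fun l => l[a.length + 1]?) hg
    simpa [-List.ofFn_succ, List.getElem?_ofFn, Fin.last] using this
  rw [← hg] at hnd hch ⊢
  have hsucc : ∀ t : Fin (a.length + 1), (t.castSucc : Fin (a.length + 2)) + 1 = t.succ :=
    fun t => by simp
  have hlast : (Fin.last (a.length + 1) : Fin (a.length + 2)) + 1 = 0 := by simp
  refine ⟨a.length, g, List.nodup_ofFn.1 hnd, ?_, ?_⟩
  · change ∀ t : Fin (a.length + 2), R (g t) (g (t + 1))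
    intro t
    refine Fin.lastCases ?_ (fun t => ?_) t
    · rw [hlast, h0, hl]; exact hR
    · rw [hsucc]
      have := List.isChain_iff_getElem.1 hch t.1 (by rw [List.length_ofFn]; omega)
      rw [List.getElem_ofFn, List.getElem_ofFn] at this
      exact this
  · change ∑ t : Fin (a.length + 2), w (g t) (g (t + 1)) = _
    rw [Fin.sum_univ_castSucc, hlast, h0, hl, pathWeight_ofFn]
    simp only [hsucc]

/-- A finite loopless weighted digraph has a simple cycle of positive weight or a potential. -/
theorem exists_pos_cycle_or_potential {V : Type*} [Finite V] (R : V → V → Prop)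
    (hR : ∀ i, ¬ R i i) (w : V → V → ℝ) :
    (∃ (m : ℕ) (c : ZMod (m + 2) → V), Function.Injective c ∧
      (∀ t, R (c t) (c (t + 1))) ∧ 0 < ∑ t, w (c t) (c (t + 1))) ∨
    ∃ φ : V → ℝ, ∀ i j, R i j → φ i + w i j ≤ φ j := by
  classical
  have := Fintype.ofFinite V
  by_cases hcyc : ∃ (m : ℕ) (c : ZMod (m + 2) → V), Function.Injective c ∧
      (∀ t, R (c t) (c (t + 1))) ∧ 0 < ∑ t, w (c t) (c (t + 1))
  · exact Or.inl hcyc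
  right
  have hbest : ∀ i : V, ∃ l : List V, ((i :: l).Nodup ∧ (i :: l).IsChain R) ∧
      ∀ l' : List V, (i :: l').Nodup ∧ (i :: l').IsChain R →
        pathWeight w (i :: l') ≤ pathWeight w (i :: l) := by
    intro i
    have hfin : {l : List V | (i :: l).Nodup ∧ (i :: l).IsChain R}.Finite := by
      refine (List.finite_length_le V (Fintype.card V)).subset ?_
      rintro l ⟨h, -⟩
      exact (List.nodup_cons.1 h).2.length_le_card
    exact Set.exists_max_image _ (fun l => pathWeight w (i :: l)) hfin
      ⟨[], List.nodup_singleton i, List.isChain_singleton i⟩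
  choose p hp hmax using hbest
  refine ⟨fun i => -pathWeight w (i :: p i), fun i j hij => ?_⟩
  have hne : i ≠ j := by rintro rfl; exact hR i hij
  suffices w i j + pathWeight w (j :: p j) ≤ pathWeight w (i :: p i) by linarith
  by_cases hmem : i ∈ p j
  · obtain ⟨a, b, hab⟩ := List.append_of_mem hmem
    have hpj := hp j
    have hw := pathWeight_append_cons w (j :: a) i b
    rw [hab] at hpj ⊢
    have hsplit : j :: (a ++ i :: b) = (j :: (a ++ [i])) ++ b := by simp
    have hsplit' : j :: (a ++ i :: b) = (j :: a) ++ (i :: b) := by simp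
    have h1 := hmax i b ⟨(hsplit' ▸ hpj.1).of_append_right, (hsplit' ▸ hpj.2).right_of_append⟩
    obtain ⟨m, c, hc, hcR, hsum⟩ := exists_cycle_of_list R w a i j
      (hsplit ▸ hpj.1).of_append_left (hsplit ▸ hpj.2).left_of_append hij
    have h2 : ¬ 0 < ∑ t, w (c t) (c (t + 1)) := fun h => hcyc ⟨m, c, hc, hcR, h⟩
    simp only [List.cons_append] at hw
    linarith
  · have := hmax i (j :: p j) ⟨List.nodup_cons.2 ⟨by simp [hne, hmem], (hp j).1⟩,
      List.isChain_cons_cons.2 ⟨hij, (hp j).2⟩⟩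
    simpa [pathWeight] using this

theorem witness_cycle_extraction
    (V : Type*) [Fintype V] [DecidableEq V] [Nonempty V]
    (E : V → V → Prop) [DecidableRel E]
    (hloop : ∀ i, ¬ E i i)
    (f : V → V → ℝ)
    (hout : ∀ i, 0 ≤ ∑ j ∈ Finset.univ.filter (fun j => E j i), f j i)
    (hhasout : ∀ i, ∃ j, E j i)
    (hrev : ∀ i j, E j i → 0 ≤ f j i → E i j → f i j < 0) :
    ∃ (m : ℕ) (c : ZMod (m + 2) → V), Function.Injective c ∧
      (∀ t, E (c (t + 1)) (c t)) ∧
      (((∀ t, 0 ≤ f (c (t + 1)) (c t)) ∧ (∃ t, ¬ E (c t) (c (t + 1)))) ∨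
       ((∀ t, 0 < f (c (t + 1)) (c t) ∧ E (c t) (c (t + 1))) ∧
        0 ≤ ∑ t : ZMod (m + 2),
          Real.log (f (c (t + 1)) (c t) / (-f (c t) (c (t + 1)))))) := by
  classical
  have hnonneg : ∀ i, ∃ j, E j i ∧ 0 ≤ f j i := by
    intro i
    by_contra! h
    obtain ⟨j, hj⟩ := hhasout i
    exact (hout i).not_gt
      (Finset.sum_neg (fun k hk => h k (by simpa using hk)) ⟨j, by simpa using hj⟩)
  rcases exists_pos_cycle_or_potential (fun i j => E j i ∧ 0 ≤ f j i) (fun i h => hloop i h.1)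
    (fun i j => if E i j then 0 else 1) with ⟨m, c, hc, hcR, hpos⟩ | ⟨ψ, hψ⟩
  · refine ⟨m, c, hc, fun t => (hcR t).1, Or.inl ⟨fun t => (hcR t).2, ?_⟩⟩
    by_contra! h
    simp [h] at hpos
  -- The maximizers of `ψ` are closed under nonnegative edges, all of which are reversible.
  obtain ⟨S, ⟨s, hs⟩, hS⟩ : ∃ S : Set V, S.Nonempty ∧
      ∀ i ∈ S, ∀ j, E j i → 0 ≤ f j i → E i j ∧ j ∈ S := by
    obtain ⟨s, hs⟩ := Finite.exists_max ψ
    refine ⟨{i | ∀ k, ψ k ≤ ψ i}, ⟨s, hs⟩, fun i hi j hE hf => ?_⟩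
    have h := hψ i j ⟨hE, hf⟩
    have hij := hi j
    by_cases hr : E i j
    · simp only [hr, if_true] at h
      exact ⟨hr, fun k => (hi k).trans (by linarith)⟩
    · simp only [hr, if_false] at h
      linarith
  rcases exists_pos_cycle_or_potential (fun i j => i ∈ S ∧ E j i ∧ 0 < f j i)
    (fun i h => hloop i h.2.1)
    (fun i j => Real.log (f j i / (-f i j))) with ⟨m, c, hc, hcR, hpos⟩ | ⟨φ, hφ⟩
  · exact ⟨m, c, hc, fun t => (hcR t).2.1, Or.inr ⟨fun t => ⟨(hcR t).2.2,
      (hS _ (hcR t).1 _ (hcR t).2.1 (hcR t).2.2.le).1⟩, hpos.le⟩⟩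
  let D : V → V → Prop := fun i j => i ∈ S ∧ E j i ∧ 0 ≤ f j i
  have hneg : ∀ i j, D i j → f i j < 0 := fun i j h =>
    hrev i j h.2.1 h.2.2 (hS i h.1 j h.2.1 h.2.2).1
  have hbal : ∀ i, 0 ≤ ∑ j, ((if D i j then f j i else 0) - (if D j i then -f j i else 0)) := by
    intro i
    by_cases hi : i ∈ S
    · refine (hout i).trans ?_
      rw [Finset.sum_filter]
      refine Finset.sum_le_sum fun j _ => ?_
      by_cases h1 : D j i
      · have h2 := hneg j i h1
        have h3 : ¬ D i j := fun h => h2.not_ge h.2.2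
        simp [h1, h3, (hS j h1.1 i h1.2.1 h1.2.2).1]
      · by_cases h3 : D i j
        · simp [h1, h3, h3.2.1]
        · by_cases h4 : E j i
          · have : f j i < 0 := by
              by_contra! h
              exact h3 ⟨hi, h4, h⟩
            simp [h1, h3, h4, this.le]
          · simp [h1, h3, h4]
    · refine Finset.sum_nonneg fun j _ => ?_
      have h1 : ¬ D i j := fun h => hi h.1
      have h2 : ¬ D j i := fun h => hi (hS j h.1 i h.2.1 h.2.2).2
      simp [h1, h2]
  let T : V → V → ℝ := fun i j =>
    Real.exp (φ i) * (if D i j then f j i else 0) - Real.exp (φ j) * (if D i j then -f i j else 0)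
  have hTsum : 0 ≤ ∑ i, ∑ j, T i j := by
    have h := Finset.sum_nonneg fun i (_ : i ∈ Finset.univ) =>
      mul_nonneg (Real.exp_pos (φ i)).le (hbal i)
    simp only [Finset.mul_sum, mul_sub, Finset.sum_sub_distrib] at h
    simp only [T, Finset.sum_sub_distrib]
    rw [Finset.sum_comm (f := fun i j => Real.exp (φ j) * (if D i j then -f i j else 0))]
    exact h
  have hTle : ∀ i j, T i j ≤ 0 := by
    intro i j
    by_cases h : D i j
    · have hn := hneg i j h
      simp only [T, h, if_true]
      rcases h.2.2.eq_or_lt with h0 | h0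
      · rw [← h0]
        nlinarith [Real.exp_pos (φ j)]
      · have h1 := hφ i j ⟨h.1, h.2.1, h0⟩
        have h2 := Real.exp_le_exp.2 h1
        rw [Real.exp_add, Real.exp_log (div_pos h0 (by linarith)), ← mul_div_assoc,
          div_le_iff₀ (by linarith)] at h2
        linarith
    · simp [T, h]
  have hTzero : ∀ i j, T i j = 0 := by
    have h0 : ∑ i, ∑ j, T i j = 0 :=
      le_antisymm (Finset.sum_nonpos fun i _ => Finset.sum_nonpos fun j _ => hTle i j) hTsum
    intro i j
    have h1 := (Finset.sum_eq_zero_iff_of_nonpos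
      fun i _ => Finset.sum_nonpos fun j _ => hTle i j).1 h0 i (Finset.mem_univ i)
    exact (Finset.sum_eq_zero_iff_of_nonpos fun j _ => hTle i j).1 h1 j (Finset.mem_univ j)
  have htight : ∀ i j, D i j → 0 < f j i ∧ Real.log (f j i / (-f i j)) = φ j - φ i := by
    intro i j h
    have hn := hneg i j h
    have h0 := hTzero i j
    simp only [T, h, if_true] at h0
    have hp : f j i / (-f i j) = Real.exp (φ j - φ i) := by
      rw [Real.exp_sub, div_eq_div_iff (by linarith) (Real.exp_pos _).ne']
      linarith
    refine ⟨?_, by rw [hp, Real.log_exp]⟩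
    rw [div_eq_iff (by linarith)] at hp
    rw [hp]
    exact mul_pos (Real.exp_pos _) (by linarith)
  rcases exists_pos_cycle_or_potential D (fun i h => hloop i h.2.1) (fun _ _ => 1) with
    ⟨m, c, hc, hcR, -⟩ | ⟨χ, hχ⟩
  · refine ⟨m, c, hc, fun t => (hcR t).2.1, Or.inr ⟨fun t => ⟨(htight _ _ (hcR t)).1,
      (hS _ (hcR t).1 _ (hcR t).2.1 (hcR t).2.2).1⟩, ?_⟩⟩
    rw [Finset.sum_congr rfl fun t _ => (htight _ _ (hcR t)).2, Finset.sum_sub_distrib,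
      Fintype.sum_equiv (Equiv.addRight (1 : ZMod (m + 2))) (fun t => φ (c (t + 1)))
        (fun t => φ (c t)) fun _ => rfl, sub_self]
  · obtain ⟨i, hi, hmax⟩ := Set.exists_max_image S χ S.toFinite ⟨s, hs⟩
    obtain ⟨j, hE, hf⟩ := hnonneg i
    have h1 := hχ i j ⟨hi, hE, hf⟩
    have h2 := hmax j (hS i hi j hE hf).2
    linarith
end

section
/- Let γ ∈ (−π/2, π/2) and σ > 0 with σ ≥ |sin γ|. Define the set Λ = { (φ, ξ) ∈ ℝ² : 0 < φ < π and ξ < ln(sin φ / σ) } and the function J(φ, ξ) = ln( (e^ξ · sin(φ − 2γ) + σ) / (e^{−ξ} · sin φ − σ) ). Then: Λ is a convex subset of ℝ²; for every (φ, ξ) ∈ Λ both e^ξ · sin(φ − 2γ) + σ > 0 and e^{−ξ} · sin φ − σ > 0 (so J is well-defined); and J is a jointly convex function on Λ. -/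
theorem discriminant_sum_of_squares (T C S G u σ s c s' c' A B : ℝ)
    (hTC : T ^ 2 + C ^ 2 = 1) (hSG : S ^ 2 + G ^ 2 = 1)
    (hs : s = T * G + C * S) (hc : c = C * G - T * S)
    (hs' : s' = T * G - C * S) (hc' : c' = C * G + T * S)
    (hA : A = u * s' + σ) (hB : B = s - σ * u) :
    σ * (A ^ 3 - u * B ^ 3 + A * B * (s' - u ^ 2 * s + 2 * σ * u * (c * c' - s * s'))) =
      T ^ 2 * (1 + (σ ^ 2 - S ^ 2)) * (σ * (u ^ 2 + 1) - 2 * C * S * u) ^ 2 +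
        (σ ^ 2 - S ^ 2) * C ^ 2 * (σ * (1 - u ^ 2) + 2 * T * G * u) ^ 2 := by
  subst hA hB hs hc hs' hc'
  have h1 : T ^ 2 = 1 - C ^ 2 := by linarith
  have h2 : G ^ 2 = 1 - S ^ 2 := by linarith
  have h13 : T ^ 3 = T * (1 - C ^ 2) := by rw [← h1]; ring
  have h14 : T ^ 4 = (1 - C ^ 2) ^ 2 := by rw [← h1]; ring
  have h23 : G ^ 3 = G * (1 - S ^ 2) := by rw [← h2]; ring
  have h24 : G ^ 4 = (1 - S ^ 2) ^ 2 := by rw [← h2]; ring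
  ring_nf
  simp only [h1, h2, h13, h14, h23, h24]
  ring

theorem quadratic_form_nonneg {P R W x y : ℝ} (hW : 0 ≤ W) (hdet : R ^ 2 ≤ P * W)
    (hP : W = 0 → 0 ≤ P) : 0 ≤ P * x ^ 2 + 2 * R * x * y + W * y ^ 2 := by
  rcases hW.eq_or_lt with h | h
  · have hR : R = 0 := by
      rw [← h, mul_zero] at hdet
      exact pow_eq_zero_iff two_ne_zero |>.1 (le_antisymm hdet (sq_nonneg R))
    rw [hR, ← h]
    nlinarith [mul_nonneg (hP h.symm) (sq_nonneg x)]
  · refine nonneg_of_mul_nonneg_right (a := W) ?_ h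
    nlinarith [sq_nonneg (W * y + R * x), mul_nonneg (sub_nonneg.2 hdet) (sq_nonneg x)]

theorem second_variation_nonneg {γ σ φ u : ℝ} (x y : ℝ) (hu : 0 < u) (hσ : 0 < σ)
    (hσγ : |Real.sin γ| ≤ σ) (hA : 0 < u * Real.sin (φ - 2 * γ) + σ)
    (hB : 0 < Real.sin φ - σ * u) :
    0 ≤ (u * (2 * x * y * Real.cos (φ - 2 * γ) + (y ^ 2 - x ^ 2) * Real.sin (φ - 2 * γ)) *
          (u * Real.sin (φ - 2 * γ) + σ) -
          (u * (x * Real.cos (φ - 2 * γ) + y * Real.sin (φ - 2 * γ))) ^ 2) *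
          (Real.sin φ - σ * u) ^ 2 -
        ((-x ^ 2 * Real.sin φ - σ * u * y ^ 2) * (Real.sin φ - σ * u) -
          (x * Real.cos φ - σ * u * y) ^ 2) * (u * Real.sin (φ - 2 * γ) + σ) ^ 2 := by
  have hTC := Real.sin_sq_add_cos_sq (φ - γ)
  have hSG := Real.sin_sq_add_cos_sq γ
  have hsc := Real.sin_sq_add_cos_sq φ
  have hsc' := Real.sin_sq_add_cos_sq (φ - 2 * γ)
  have hs : Real.sin φ = Real.sin (φ - γ) * Real.cos γ + Real.cos (φ - γ) * Real.sin γ := by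
    rw [← Real.sin_add, sub_add_cancel]
  have hc : Real.cos φ = Real.cos (φ - γ) * Real.cos γ - Real.sin (φ - γ) * Real.sin γ := by
    rw [← Real.cos_add, sub_add_cancel]
  have hs' : Real.sin (φ - 2 * γ) =
      Real.sin (φ - γ) * Real.cos γ - Real.cos (φ - γ) * Real.sin γ := by
    rw [← Real.sin_sub]; ring_nf
  have hc' : Real.cos (φ - 2 * γ) =
      Real.cos (φ - γ) * Real.cos γ + Real.sin (φ - γ) * Real.sin γ := by
    rw [← Real.cos_sub]; ring_nf
  have hδ : 0 ≤ σ ^ 2 - Real.sin γ ^ 2 := sub_nonneg.2 (sq_le_sq' (abs_le.1 hσγ).1 (abs_le.1 hσγ).2)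
  have hCS : Real.cos (φ - γ) * Real.sin γ ≤ σ := by
    refine (le_abs_self _).trans ?_
    rw [abs_mul]
    nlinarith [Real.abs_cos_le_one (φ - γ), abs_nonneg (Real.sin γ)]
  generalize Real.sin (φ - γ) = T at *
  generalize Real.cos (φ - γ) = C at *
  generalize Real.sin γ = S at *
  generalize Real.cos γ = G at *
  generalize Real.sin φ = s at *
  generalize Real.cos φ = c at *
  generalize Real.sin (φ - 2 * γ) = s' at *
  generalize Real.cos (φ - 2 * γ) = c' at *
  have hdisc := discriminant_sum_of_squares T C S G u σ s c s' c' _ _ hTC hSG hs hc hs' hc' rfl rfl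
  have hss' : 0 ≤ σ ^ 2 + s * s' := by
    have : σ ^ 2 + s * s' = T ^ 2 + (σ ^ 2 - S ^ 2) := by
      rw [hs, hs']; linear_combination T ^ 2 * hSG - S ^ 2 * hTC
    rw [this]; positivity
  have hAB : 0 ≤ (u * s' + σ) - u * (s - σ * u) := by
    rw [hs, hs']; nlinarith [mul_nonneg hu.le (sub_nonneg.2 hCS), mul_nonneg hσ.le (sq_nonneg (1 - u))]
  obtain ⟨A, hAdef⟩ : ∃ A, A = u * s' + σ := ⟨_, rfl⟩
  obtain ⟨B, hBdef⟩ : ∃ B, B = s - σ * u := ⟨_, rfl⟩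
  rw [← hAdef] at hA hAB hdisc ⊢
  rw [← hBdef] at hB hAB hdisc ⊢
  have hW : s' * B ^ 2 + s * A ^ 2 = (σ ^ 2 + s * s') * (B + u * A) := by
    rw [hAdef, hBdef]; ring
  have hD : 0 ≤ A ^ 3 - u * B ^ 3 + A * B * (s' - u ^ 2 * s + 2 * σ * u * (c * c' - s * s')) := by
    refine nonneg_of_mul_nonneg_right (a := σ) ?_ hσ
    rw [hdisc]; positivity
  have key := quadratic_form_nonneg (x := x) (y := y)
    (P := (1 - σ * u * s) * A ^ 2 - u * (σ * s' + u) * B ^ 2)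
    (R := σ * u * (c' * B ^ 2 - c * A ^ 2)) (W := σ * u * (s' * B ^ 2 + s * A ^ 2))
    (by rw [hW]; positivity) ?_ ?_
  · refine key.trans_eq ?_
    subst hAdef hBdef
    linear_combination (-x ^ 2 * (u * s' + σ) ^ 2) * hsc + u ^ 2 * x ^ 2 * (s - σ * u) ^ 2 * hsc'
  · have := mul_nonneg (mul_pos (mul_pos hσ hu) (mul_pos hA hB)).le hD
    rw [← sub_nonneg]
    refine this.trans_eq ?_
    subst hAdef hBdef
    linear_combination σ ^ 2 * u ^ 2 * (s - σ * u) ^ 4 * hsc' +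
      σ ^ 2 * u ^ 2 * (u * s' + σ) ^ 4 * hsc
  · intro h
    have h0 : s' * B ^ 2 + s * A ^ 2 = 0 := (mul_eq_zero.1 h).resolve_left (by positivity)
    have : (1 - σ * u * s) * A ^ 2 - u * (σ * s' + u) * B ^ 2 = (A - u * B) * (A + u * B) := by
      linear_combination (-σ * u) * h0
    rw [this]; positivity

theorem convex_log_sin_strict_hypograph {σ : ℝ} (hσ : 0 < σ) :
    Convex ℝ {p : ℝ × ℝ | 0 < p.1 ∧ p.1 < Real.pi ∧ p.2 < Real.log (Real.sin p.1 / σ)} := by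
  have hsin : ConcaveOn ℝ (Set.Ioo 0 Real.pi) fun φ => Real.sin φ / σ := by
    simpa only [div_eq_inv_mul, smul_eq_mul] using
      (strictConcaveOn_sin_Icc.concaveOn.subset Set.Ioo_subset_Icc_self (convex_Ioo _ _)).smul
        (inv_pos.2 hσ).le
  have hpos : ∀ φ ∈ Set.Ioo 0 Real.pi, 0 < Real.sin φ / σ := fun φ hφ =>
    div_pos (Real.sin_pos_of_mem_Ioo hφ) hσ
  have hlog : ConcaveOn ℝ (Set.Ioo 0 Real.pi) fun φ => Real.log (Real.sin φ / σ) := by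
    refine ⟨convex_Ioo _ _, fun x hx y hy a b ha hb hab => ?_⟩
    have hx' := hpos x hx
    have hy' := hpos y hy
    refine (strictConcaveOn_log_Ioi.concaveOn.2 hx' hy' ha hb hab).trans
      (Real.log_le_log ?_ (hsin.2 hx hy ha hb hab))
    exact (convex_Ioi (0 : ℝ)) hx' hy' ha hb hab
  simpa only [Set.mem_Ioo, and_assoc] using hlog.convex_strict_hypograph

theorem exp_mul_lt_sin {σ φ ξ : ℝ} (hσ : 0 < σ) (h₀ : 0 < φ) (h₁ : φ < Real.pi)
    (h : ξ < Real.log (Real.sin φ / σ)) : σ * Real.exp ξ < Real.sin φ := by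
  rw [Real.lt_log_iff_exp_lt (div_pos (Real.sin_pos_of_pos_of_lt_pi h₀ h₁) hσ), lt_div_iff₀ hσ] at h
  linarith

theorem exp_mul_sin_sub_add_pos {γ σ φ u : ℝ} (hu : 0 < u) (hσ : 0 < σ)
    (hσγ : |Real.sin γ| ≤ σ) (hB : σ * u < Real.sin φ) :
    0 < u * Real.sin (φ - 2 * γ) + σ := by
  rcases le_or_gt 0 (Real.sin (φ - 2 * γ)) with h | h
  · positivity
  have hprod : Real.sin φ * Real.sin (φ - 2 * γ) =
      Real.sin (φ - γ) ^ 2 - Real.sin γ ^ 2 := by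
    have hs : Real.sin φ = Real.sin (φ - γ + γ) := by ring_nf
    have hs' : Real.sin (φ - 2 * γ) = Real.sin (φ - γ - γ) := by ring_nf
    rw [hs, hs', Real.sin_add, Real.sin_sub (φ - γ) γ]
    linear_combination Real.sin (φ - γ) ^ 2 * Real.sin_sq_add_cos_sq γ -
      Real.sin γ ^ 2 * Real.sin_sq_add_cos_sq (φ - γ)
  have hsq : Real.sin γ ^ 2 ≤ σ ^ 2 := sq_le_sq' (abs_le.1 hσγ).1 (abs_le.1 hσγ).2
  refine pos_of_mul_pos_right (a := σ) ?_ hσ.le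
  nlinarith [mul_pos (sub_pos.2 hB) (neg_pos.2 h), sq_nonneg (Real.sin (φ - γ))]

theorem convexOn_segment_of_pos {γ σ : ℝ} (hσ : 0 < σ) (hσγ : |Real.sin γ| ≤ σ) (φ ξ x y : ℝ)
    (hpos : ∀ t ∈ Set.Icc (0 : ℝ) 1,
      0 < Real.exp (ξ + t * y) * Real.sin (φ + t * x - 2 * γ) + σ ∧
      0 < Real.sin (φ + t * x) - σ * Real.exp (ξ + t * y)) :
    ConvexOn ℝ (Set.Icc 0 1) fun t : ℝ =>
      Real.log (Real.exp (ξ + t * y) * Real.sin (φ + t * x - 2 * γ) + σ) -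
        Real.log (Real.sin (φ + t * x) - σ * Real.exp (ξ + t * y)) + (ξ + t * y) := by
  have hξ (t : ℝ) : HasDerivAt (fun t => ξ + t * y) y t := by
    simpa using ((hasDerivAt_id t).mul_const y).const_add ξ
  have hφ (t : ℝ) : HasDerivAt (fun t => φ + t * x) x t := by
    simpa using ((hasDerivAt_id t).mul_const x).const_add φ
  have hφ' (t : ℝ) : HasDerivAt (fun t => φ + t * x - 2 * γ) x t := (hφ t).sub_const _
  let A : ℝ → ℝ := fun t => Real.exp (ξ + t * y) * Real.sin (φ + t * x - 2 * γ) + σ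
  let B : ℝ → ℝ := fun t => Real.sin (φ + t * x) - σ * Real.exp (ξ + t * y)
  let A' : ℝ → ℝ := fun t => Real.exp (ξ + t * y) *
    (x * Real.cos (φ + t * x - 2 * γ) + y * Real.sin (φ + t * x - 2 * γ))
  let B' : ℝ → ℝ := fun t => x * Real.cos (φ + t * x) - σ * Real.exp (ξ + t * y) * y
  let A'' : ℝ → ℝ := fun t => Real.exp (ξ + t * y) *
    (2 * x * y * Real.cos (φ + t * x - 2 * γ) + (y ^ 2 - x ^ 2) * Real.sin (φ + t * x - 2 * γ))
  let B'' : ℝ → ℝ := fun t => -x ^ 2 * Real.sin (φ + t * x) - σ * Real.exp (ξ + t * y) * y ^ 2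
  have hA (t : ℝ) : HasDerivAt A (A' t) t :=
    (((hξ t).exp.mul (hφ' t).sin).add_const σ).congr_deriv (by simp only [A']; ring)
  have hB (t : ℝ) : HasDerivAt B (B' t) t :=
    ((hφ t).sin.sub ((hξ t).exp.const_mul σ)).congr_deriv (by simp only [B']; ring)
  have hA' (t : ℝ) : HasDerivAt A' (A'' t) t :=
    ((hξ t).exp.mul (((hφ' t).cos.const_mul x).add ((hφ' t).sin.const_mul y))).congr_deriv
      (by simp only [A'', Pi.add_apply]; ring)
  have hB' (t : ℝ) : HasDerivAt B' (B'' t) t :=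
    (((hφ t).cos.const_mul x).sub (((hξ t).exp.const_mul σ).mul_const y)).congr_deriv
      (by simp only [B'']; ring)
  have hf (t : ℝ) (ht : t ∈ Set.Icc (0 : ℝ) 1) :
      HasDerivAt (fun t => Real.log (A t) - Real.log (B t) + (ξ + t * y))
        (A' t / A t - B' t / B t + y) t :=
    (((hA t).log (hpos t ht).1.ne').sub ((hB t).log (hpos t ht).2.ne')).add (hξ t)
  refine convexOn_of_hasDerivWithinAt2_nonneg (convex_Icc 0 1)
    (f' := fun t => A' t / A t - B' t / B t + y)
    (f'' := fun t => (A'' t * A t - A' t * A' t) / A t ^ 2 - (B'' t * B t - B' t * B' t) / B t ^ 2)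
    (fun t ht => (hf t ht).continuousAt.continuousWithinAt)
    (fun t ht => (hf t (interior_subset ht)).hasDerivWithinAt) (fun t ht => ?_) fun t ht => ?_
  · obtain ⟨hApos, hBpos⟩ := hpos t (interior_subset ht)
    exact ((((hA' t).div (hA t) hApos.ne').sub ((hB' t).div (hB t) hBpos.ne')).add_const
      y).hasDerivWithinAt
  · obtain ⟨hApos, hBpos⟩ := hpos t (interior_subset ht)
    have h := second_variation_nonneg x y (Real.exp_pos (ξ + t * y)) hσ hσγ hApos hBpos
    have hA0 : 0 < A t := hApos
    have hB0 : 0 < B t := hBpos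
    rw [div_sub_div _ _ (pow_pos hA0 2).ne' (pow_pos hB0 2).ne']
    refine div_nonneg (h.trans_eq ?_) (by positivity)
    simp only [A, B, A', B', A'', B'']
    ring

theorem J_convexity
    (γ σ : ℝ) (hγ₁ : -(Real.pi / 2) < γ) (hγ₂ : γ < Real.pi / 2)
    (hσ : 0 < σ) (hσγ : |Real.sin γ| ≤ σ) :
    Convex ℝ {p : ℝ × ℝ | 0 < p.1 ∧ p.1 < Real.pi ∧ p.2 < Real.log (Real.sin p.1 / σ)} ∧
    (∀ p ∈ {p : ℝ × ℝ | 0 < p.1 ∧ p.1 < Real.pi ∧ p.2 < Real.log (Real.sin p.1 / σ)},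
      0 < Real.exp p.2 * Real.sin (p.1 - 2 * γ) + σ ∧
      0 < Real.exp (-p.2) * Real.sin p.1 - σ) ∧
    ConvexOn ℝ {p : ℝ × ℝ | 0 < p.1 ∧ p.1 < Real.pi ∧ p.2 < Real.log (Real.sin p.1 / σ)}
      (fun p => Real.log ((Real.exp p.2 * Real.sin (p.1 - 2 * γ) + σ) /
        (Real.exp (-p.2) * Real.sin p.1 - σ))) := by
  have hconv := convex_log_sin_strict_hypograph hσ
  have hAB : ∀ p ∈ {p : ℝ × ℝ | 0 < p.1 ∧ p.1 < Real.pi ∧ p.2 < Real.log (Real.sin p.1 / σ)},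
      0 < Real.exp p.2 * Real.sin (p.1 - 2 * γ) + σ ∧ 0 < Real.sin p.1 - σ * Real.exp p.2 := by
    rintro p ⟨h₀, h₁, h⟩
    have hB := exp_mul_lt_sin hσ h₀ h₁ h
    exact ⟨exp_mul_sin_sub_add_pos (Real.exp_pos _) hσ hσγ hB, sub_pos.2 hB⟩
  have hden : ∀ p : ℝ × ℝ, Real.exp (-p.2) * Real.sin p.1 - σ =
      Real.exp (-p.2) * (Real.sin p.1 - σ * Real.exp p.2) := fun p => by
    have := Real.exp_pos p.2
    rw [Real.exp_neg]; field_simp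
  refine ⟨hconv, fun p hp => ⟨(hAB p hp).1, ?_⟩, hconv, fun p hp q hq a b ha hb hab => ?_⟩
  · rw [hden]
    exact mul_pos (Real.exp_pos _) (hAB p hp).2
  have hJ : ∀ p ∈ {p : ℝ × ℝ | 0 < p.1 ∧ p.1 < Real.pi ∧ p.2 < Real.log (Real.sin p.1 / σ)},
      Real.log ((Real.exp p.2 * Real.sin (p.1 - 2 * γ) + σ) /
        (Real.exp (-p.2) * Real.sin p.1 - σ)) =
      Real.log (Real.exp p.2 * Real.sin (p.1 - 2 * γ) + σ) -
        Real.log (Real.sin p.1 - σ * Real.exp p.2) + p.2 := fun p hp => by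
    obtain ⟨hA, hB⟩ := hAB p hp
    rw [hden, Real.log_div hA.ne' (by positivity), Real.log_mul (Real.exp_pos _).ne' hB.ne',
      Real.log_exp]
    ring
  have hmem : ∀ t ∈ Set.Icc (0 : ℝ) 1, (p.1 + t * (q.1 - p.1), p.2 + t * (q.2 - p.2)) ∈
      {p : ℝ × ℝ | 0 < p.1 ∧ p.1 < Real.pi ∧ p.2 < Real.log (Real.sin p.1 / σ)} := fun t ht => by
    exact hconv.add_smul_sub_mem hp hq ht
  have hline := convexOn_segment_of_pos (γ := γ) hσ hσγ p.1 p.2 (q.1 - p.1) (q.2 - p.2)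
    fun t ht => hAB _ (hmem t ht)
  have hend := hline.2 (Set.left_mem_Icc.2 zero_le_one) (Set.right_mem_Icc.2 zero_le_one) ha hb hab
  have hpt : a • p + b • q = (p.1 + b * (q.1 - p.1), p.2 + b * (q.2 - p.2)) := by
    obtain rfl : a = 1 - b := by linarith
    ext <;> simp <;> ring
  have hb1 : b ∈ Set.Icc (0 : ℝ) 1 := ⟨hb, by linarith⟩
  simp only [hpt]
  rw [hJ _ (hmem b hb1), hJ p hp, hJ q hq]
  simpa using hend
end

section
/- Let ψ ∈ (0, π/2). Define Λ_ψ = { (θ, ξ) ∈ ℝ² : −ψ < θ < π − ψ and ξ < ln( sin(θ + ψ) / sin ψ ) } and K_ψ(θ, ξ) = ln( (e^ξ · sin(θ − ψ) + sin ψ) / (e^{−ξ} · sin(θ + ψ) − sin ψ) ). Then Λ_ψ is a convex subset of ℝ², K_ψ is well-defined on Λ_ψ (both the numerator e^ξ·sin(θ−ψ) + sin ψ and the denominator e^{−ξ}·sin(θ+ψ) − sin ψ are positive there), and K_ψ is jointly convex on Λ_ψ. -/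
open Real Set

theorem sq_mul_add_sq_mul_factor {S C s k : ℝ} (x : ℝ)
    (hS : S ^ 2 + C ^ 2 = 1) (hs : s ^ 2 + k ^ 2 = 1) :
    (S * k - C * s) * (S * k + C * s - s * x) ^ 2 +
        (S * k + C * s) * (s + x * (S * k - C * s)) ^ 2 =
      S ^ 2 * ((S * k + C * s) + x ^ 2 * (S * k - C * s)) := by grind

theorem sq_mul_sub_sq_mul_factor {S C s k : ℝ} (x : ℝ)
    (hS : S ^ 2 + C ^ 2 = 1) (hs : s ^ 2 + k ^ 2 = 1) :
    (C * k + S * s) * (S * k + C * s - s * x) ^ 2 -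
        (C * k - S * s) * (s + x * (S * k - C * s)) ^ 2 =
      S * (2 * s * (1 - 2 * x * C + x ^ 2) +
        S * ((C * k - S * s) - x ^ 2 * (C * k + S * s))) := by grind

theorem hessian_det_factor {S C s k : ℝ} (x : ℝ)
    (hS : S ^ 2 + C ^ 2 = 1) (hs : s ^ 2 + k ^ 2 = 1) :
    (s * (1 - 2 * x * C + x ^ 2) * (s + 2 * x * S * k - s * x ^ 2) -
          x * s * S ^ 2 * ((S * k + C * s) + x ^ 2 * (S * k - C * s))) *
        (x * s * S ^ 2 * ((S * k + C * s) + x ^ 2 * (S * k - C * s))) -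
      (x * s * (S * (2 * s * (1 - 2 * x * C + x ^ 2) +
        S * ((C * k - S * s) - x ^ 2 * (C * k + S * s))))) ^ 2 =
      x * s ^ 2 * S ^ 2 * (1 - 2 * x * C + x ^ 2) ^ 2 *
        ((s + x * (S * k - C * s)) * (S * k + C * s - s * x)) := by
  have h₁ : ((S * k + C * s) + x ^ 2 * (S * k - C * s)) * (s + 2 * x * S * k - s * x ^ 2) -
      x * S ^ 2 * (1 + x ^ 2 + 2 * x * C) - 4 * x * s ^ 2 * (1 - 2 * x * C + x ^ 2) -
      4 * x * s * S * ((C * k - S * s) - x ^ 2 * (C * k + S * s)) =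
      (s + x * (S * k - C * s)) * (S * k + C * s - s * x) * (1 - 2 * x * C + x ^ 2) := by grind
  have h₂ : ((S * k + C * s) + x ^ 2 * (S * k - C * s)) ^ 2 +
      ((C * k - S * s) - x ^ 2 * (C * k + S * s)) ^ 2 =
      (1 - 2 * x * C + x ^ 2) * (1 + x ^ 2 + 2 * x * C) := by grind
  linear_combination x * s ^ 2 * S ^ 2 * (1 - 2 * x * C + x ^ 2) * h₁ - x ^ 2 * s ^ 2 * S ^ 4 * h₂

theorem quadratic_form_nonneg_s19 {A B C : ℝ} (hC : 0 < C) (hdet : 0 ≤ A * C - B ^ 2) (u v : ℝ) :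
    0 ≤ A * u ^ 2 + 2 * B * u * v + C * v ^ 2 := by
  refine (mul_nonneg_iff_of_pos_left hC).1 ?_
  have : C * (A * u ^ 2 + 2 * B * u * v + C * v ^ 2) =
    (C * v + B * u) ^ 2 + (A * C - B ^ 2) * u ^ 2 := by ring
  rw [this]
  positivity

theorem hessian_nonneg {S C s k x : ℝ} (hS : S ^ 2 + C ^ 2 = 1) (hs : s ^ 2 + k ^ 2 = 1)
    (hs₀ : 0 < s) (hx : 0 < x) (hb : 0 < S * k + C * s)
    (hN : 0 < s + x * (S * k - C * s)) (hG : 0 < S * k + C * s - s * x) (u v : ℝ) :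
    0 ≤ (S * k + C * s - s * x) ^ 2 *
        ((x * v ^ 2 * (S * k - C * s) + 2 * x * u * v * (C * k + S * s)
            - x * u ^ 2 * (S * k - C * s)) * (s + x * (S * k - C * s)) -
          (x * v * (S * k - C * s) + x * u * (C * k + S * s)) ^ 2) -
      (s + x * (S * k - C * s)) ^ 2 *
        ((-u ^ 2 * (S * k + C * s) - s * v ^ 2 * x) * (S * k + C * s - s * x) -
          (u * (C * k - S * s) - s * v * x) ^ 2) := by
  have hA : (1 - s * x * (S * k + C * s)) * (s + x * (S * k - C * s)) ^ 2 -
      (x ^ 2 + s * x * (S * k - C * s)) * (S * k + C * s - s * x) ^ 2 =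
      s * (1 - 2 * x * C + x ^ 2) * (s + 2 * x * S * k - s * x ^ 2) -
        x * s * S ^ 2 * ((S * k + C * s) + x ^ 2 * (S * k - C * s)) := by
    linear_combination (-x * s) * sq_mul_add_sq_mul_factor x hS hs
  have hform : (S * k + C * s - s * x) ^ 2 *
        ((x * v ^ 2 * (S * k - C * s) + 2 * x * u * v * (C * k + S * s)
            - x * u ^ 2 * (S * k - C * s)) * (s + x * (S * k - C * s)) -
          (x * v * (S * k - C * s) + x * u * (C * k + S * s)) ^ 2) -
      (s + x * (S * k - C * s)) ^ 2 *
        ((-u ^ 2 * (S * k + C * s) - s * v ^ 2 * x) * (S * k + C * s - s * x) -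
          (u * (C * k - S * s) - s * v * x) ^ 2) =
      (s * (1 - 2 * x * C + x ^ 2) * (s + 2 * x * S * k - s * x ^ 2) -
        x * s * S ^ 2 * ((S * k + C * s) + x ^ 2 * (S * k - C * s))) * u ^ 2 +
      2 * (x * s * (S * (2 * s * (1 - 2 * x * C + x ^ 2) +
        S * ((C * k - S * s) - x ^ 2 * (C * k + S * s))))) * u * v +
      (x * s * S ^ 2 * ((S * k + C * s) + x ^ 2 * (S * k - C * s))) * v ^ 2 := by
    have hac : (S * k - C * s) ^ 2 + (C * k + S * s) ^ 2 = 1 := by grind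
    have hbd : (S * k + C * s) ^ 2 + (C * k - S * s) ^ 2 = 1 := by grind
    linear_combination u ^ 2 * hA + 2 * x * s * u * v * sq_mul_sub_sq_mul_factor x hS hs +
      x * s * v ^ 2 * sq_mul_add_sq_mul_factor x hS hs -
      u ^ 2 * x ^ 2 * (S * k + C * s - s * x) ^ 2 * hac +
      u ^ 2 * (s + x * (S * k - C * s)) ^ 2 * hbd
  rw [hform]
  rcases eq_or_ne S 0 with rfl | hS₀
  · have hC : C = 1 := by
      have : 0 < C := pos_of_mul_pos_left (by linarith) hs₀.le
      nlinarith
    subst hC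
    have hx₁ : 0 < 1 - x := pos_of_mul_pos_right (a := s) (by linarith) hs₀.le
    have : 0 ≤ s ^ 2 * (1 - x) ^ 3 * (1 + x) * u ^ 2 := by positivity
    linear_combination this
  · refine quadratic_form_nonneg_s19 ?_ ?_ u v
    · have hU : 0 < (S * k + C * s) + x ^ 2 * (S * k - C * s) := by
        rcases le_or_gt 0 (S * k - C * s) with ha | ha
        · positivity
        · refine pos_of_mul_pos_right (a := s ^ 2) ?_ (sq_nonneg s)
          have hU : s ^ 2 * ((S * k + C * s) + x ^ 2 * (S * k - C * s)) =
              (S * k + C * s) * S ^ 2 +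
                -(S * k - C * s) * ((S * k + C * s - s * x) * (S * k + C * s + s * x)) := by
            grind
          have := neg_pos.2 ha
          rw [hU]
          positivity
      positivity
    · rw [hessian_det_factor x hS hs]
      positivity

theorem convexOn_segment_log_sub_log {ψ x y u v : ℝ} (hψ : 0 < sin ψ)
    (hb : ∀ t ∈ Icc (0 : ℝ) 1, 0 < sin (x + t * u + ψ))
    (hN : ∀ t ∈ Icc (0 : ℝ) 1, 0 < exp (y + t * v) * sin (x + t * u - ψ) + sin ψ)
    (hG : ∀ t ∈ Icc (0 : ℝ) 1, 0 < sin (x + t * u + ψ) - sin ψ * exp (y + t * v)) :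
    ConvexOn ℝ (Icc 0 1) (fun t => log (exp (y + t * v) * sin (x + t * u - ψ) + sin ψ) -
      log (sin (x + t * u + ψ) - sin ψ * exp (y + t * v))) := by
  have hlin (x u t : ℝ) : HasDerivAt (fun t => x + t * u) u t := by
    simpa using ((hasDerivAt_id t).mul_const u).const_add x
  have hE (t : ℝ) : HasDerivAt (fun t => exp (y + t * v)) (exp (y + t * v) * v) t :=
    (hlin y v t).exp
  have ha (t : ℝ) : HasDerivAt (fun t => sin (x + t * u - ψ)) (cos (x + t * u - ψ) * u) t :=
    ((hlin x u t).sub_const ψ).sin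
  have hc (t : ℝ) : HasDerivAt (fun t => cos (x + t * u - ψ)) (-sin (x + t * u - ψ) * u) t :=
    ((hlin x u t).sub_const ψ).cos
  have hb' (t : ℝ) : HasDerivAt (fun t => sin (x + t * u + ψ)) (cos (x + t * u + ψ) * u) t :=
    ((hlin x u t).add_const ψ).sin
  have hd (t : ℝ) : HasDerivAt (fun t => cos (x + t * u + ψ)) (-sin (x + t * u + ψ) * u) t :=
    ((hlin x u t).add_const ψ).cos
  have hN₁ (t : ℝ) := ((hE t).mul (ha t)).add_const (sin ψ)
  have hG₁ (t : ℝ) := (hb' t).sub ((hE t).const_mul (sin ψ))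
  have hN₂ (t : ℝ) := (((hE t).mul_const v).mul (ha t)).add ((hE t).mul ((hc t).mul_const u))
  have hG₂ (t : ℝ) := ((hd t).mul_const u).sub (((hE t).mul_const v).const_mul (sin ψ))
  have hf' (t : ℝ) (ht : t ∈ Icc (0 : ℝ) 1) :=
    ((hN₁ t).log (hN t ht).ne').sub ((hG₁ t).log (hG t ht).ne')
  have hf'' (t : ℝ) (ht : t ∈ Icc (0 : ℝ) 1) :=
    ((hN₂ t).div (hN₁ t) (hN t ht).ne').sub ((hG₂ t).div (hG₁ t) (hG t ht).ne')
  refine convexOn_of_hasDerivWithinAt2_nonneg (convex_Icc 0 1)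
    (fun t ht => (hf' t ht).continuousAt.continuousWithinAt)
    (fun t ht => (hf' t (interior_subset ht)).hasDerivWithinAt)
    (fun t ht => (hf'' t (interior_subset ht)).hasDerivWithinAt) fun t ht => ?_
  replace ht := interior_subset ht
  have hNt := hN t ht
  have hGt := hG t ht
  have hbt := hb t ht
  simp only [Pi.mul_apply, Pi.sub_apply, Pi.add_apply]
  rw [div_sub_div _ _ (pow_pos hNt 2).ne' (pow_pos hGt 2).ne']
  refine div_nonneg ?_ (by positivity)
  rw [sin_add] at hbt hGt
  rw [sin_sub] at hNt
  have key := hessian_nonneg (sin_sq_add_cos_sq (x + t * u)) (sin_sq_add_cos_sq ψ) hψ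
    (exp_pos (y + t * v)) hbt (by linarith) hGt u v
  rw [sin_add _ ψ, sin_sub _ ψ, cos_add _ ψ, cos_sub _ ψ]
  refine key.trans_eq ?_
  ring

theorem convexOn_log_sub_log {ψ : ℝ} (hψ : 0 < sin ψ) {Λ : Set (ℝ × ℝ)} (hΛ : Convex ℝ Λ)
    (hb : ∀ p ∈ Λ, 0 < sin (p.1 + ψ))
    (hN : ∀ p ∈ Λ, 0 < exp p.2 * sin (p.1 - ψ) + sin ψ)
    (hG : ∀ p ∈ Λ, 0 < sin (p.1 + ψ) - sin ψ * exp p.2) :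
    ConvexOn ℝ Λ (fun p => log (exp p.2 * sin (p.1 - ψ) + sin ψ) -
      log (sin (p.1 + ψ) - sin ψ * exp p.2)) := by
  refine ⟨hΛ, ?_⟩
  intro p hp q hq a b ha hb' hab
  have hmem : ∀ t ∈ Icc (0 : ℝ) 1,
      (p.1 + t * (q.1 - p.1), p.2 + t * (q.2 - p.2)) ∈ Λ := fun t ht => by
    have h := hΛ.add_smul_sub_mem hp hq ht
    have heq : p + t • (q - p) = (p.1 + t * (q.1 - p.1), p.2 + t * (q.2 - p.2)) := by
      ext <;> simp
    rwa [heq] at h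
  have hb₁ (t : ℝ) (ht : t ∈ Icc (0 : ℝ) 1) := hb _ (hmem t ht)
  have hN₁ (t : ℝ) (ht : t ∈ Icc (0 : ℝ) 1) := hN _ (hmem t ht)
  have hG₁ (t : ℝ) (ht : t ∈ Icc (0 : ℝ) 1) := hG _ (hmem t ht)
  have hseg := convexOn_segment_log_sub_log hψ hb₁ hN₁ hG₁
  replace hseg := hseg.2 (left_mem_Icc.2 zero_le_one) (right_mem_Icc.2 zero_le_one) ha hb' hab
  have h₁ : (a • p + b • q).1 = p.1 + b * (q.1 - p.1) := by
    simp only [Prod.fst_add, Prod.smul_fst, smul_eq_mul]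
    linear_combination p.1 * hab
  have h₂ : (a • p + b • q).2 = p.2 + b * (q.2 - p.2) := by
    simp only [Prod.snd_add, Prod.smul_snd, smul_eq_mul]
    linear_combination p.2 * hab
  simp only [smul_eq_mul, mul_zero, mul_one, zero_mul, one_mul, zero_add, add_zero,
    add_sub_cancel] at hseg
  simpa only [h₁, h₂, smul_eq_mul] using hseg

theorem convex_setOf_lt_log_sin_div {ψ : ℝ} (hψ : 0 < sin ψ) :
    Convex ℝ {p : ℝ × ℝ | -ψ < p.1 ∧ p.1 < π - ψ ∧ p.2 < log (sin (p.1 + ψ) / sin ψ)} := by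
  rintro ⟨x₁, y₁⟩ ⟨h₁, h₂, h₃⟩ ⟨x₂, y₂⟩ ⟨h₄, h₅, h₆⟩ a b ha hb hab
  dsimp only at *
  have hs₁ : 0 < sin (x₁ + ψ) := sin_pos_of_pos_of_lt_pi (by linarith) (by linarith)
  have hs₂ : 0 < sin (x₂ + ψ) := sin_pos_of_pos_of_lt_pi (by linarith) (by linarith)
  have hx := convex_Ioo (-ψ) (π - ψ) ⟨h₁, h₂⟩ ⟨h₄, h₅⟩ ha hb hab
  refine ⟨hx.1, hx.2, ?_⟩
  have hy := convex_Iio (𝕜 := ℝ) (0 : ℝ) (sub_neg.2 h₃) (sub_neg.2 h₆) ha hb hab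
  have hsin := strictConcaveOn_sin_Icc.concaveOn.2 (x := x₁ + ψ) (y := x₂ + ψ)
    ⟨by linarith, by linarith⟩ ⟨by linarith, by linarith⟩ ha hb hab
  have hlog := strictConcaveOn_log_Ioi.concaveOn.2 (div_pos hs₁ hψ) (div_pos hs₂ hψ) ha hb hab
  have hpos := convex_Ioi (𝕜 := ℝ) (0 : ℝ) (div_pos hs₁ hψ) (div_pos hs₂ hψ) ha hb hab
  simp only [smul_eq_mul, mem_Iio, mem_Ioi, Prod.smul_mk, Prod.mk_add_mk] at *
  have harg : a * (x₁ + ψ) + b * (x₂ + ψ) = a * x₁ + b * x₂ + ψ := by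
    linear_combination ψ * hab
  rw [harg] at hsin
  have hmono : log (a * (sin (x₁ + ψ) / sin ψ) + b * (sin (x₂ + ψ) / sin ψ)) ≤
      log (sin (a * x₁ + b * x₂ + ψ) / sin ψ) := by
    refine log_le_log hpos ?_
    rw [mul_div_assoc', mul_div_assoc', ← add_div]
    gcongr
  linarith

theorem exp_mul_sin_lt_of_lt_log {ψ x y : ℝ} (hψ : 0 < sin ψ) (hb : 0 < sin (x + ψ))
    (h : y < log (sin (x + ψ) / sin ψ)) : sin ψ * exp y < sin (x + ψ) := by
  rw [lt_log_iff_exp_lt (div_pos hb hψ), lt_div_iff₀ hψ] at h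
  linarith

theorem exp_mul_sin_sub_add_sin_pos {ψ x y : ℝ} (hψ : 0 < sin ψ)
    (h : sin ψ * exp y < sin (x + ψ)) : 0 < exp y * sin (x - ψ) + sin ψ := by
  rcases le_or_gt 0 (sin (x - ψ)) with ha | ha
  · positivity
  · refine pos_of_mul_pos_right (a := sin ψ) ?_ hψ.le
    have hprod : sin (x + ψ) * sin (x - ψ) = sin x ^ 2 - sin ψ ^ 2 := by
      rw [sin_add, sin_sub]
      linear_combination sin x ^ 2 * cos_sq' ψ - sin ψ ^ 2 * cos_sq' x
    nlinarith [mul_lt_mul_of_neg_right h ha, sq_nonneg (sin x)]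

theorem K_convexity
    (ψ : ℝ) (hψ₁ : 0 < ψ) (hψ₂ : ψ < Real.pi / 2) :
    Convex ℝ {p : ℝ × ℝ | -ψ < p.1 ∧ p.1 < Real.pi - ψ ∧
      p.2 < Real.log (Real.sin (p.1 + ψ) / Real.sin ψ)} ∧
    (∀ p ∈ {p : ℝ × ℝ | -ψ < p.1 ∧ p.1 < Real.pi - ψ ∧
        p.2 < Real.log (Real.sin (p.1 + ψ) / Real.sin ψ)},
      0 < Real.exp p.2 * Real.sin (p.1 - ψ) + Real.sin ψ ∧
      0 < Real.exp (-p.2) * Real.sin (p.1 + ψ) - Real.sin ψ) ∧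
    ConvexOn ℝ {p : ℝ × ℝ | -ψ < p.1 ∧ p.1 < Real.pi - ψ ∧
        p.2 < Real.log (Real.sin (p.1 + ψ) / Real.sin ψ)}
      (fun p => Real.log ((Real.exp p.2 * Real.sin (p.1 - ψ) + Real.sin ψ) /
        (Real.exp (-p.2) * Real.sin (p.1 + ψ) - Real.sin ψ))) := by
  have hψ : 0 < sin ψ := sin_pos_of_pos_of_lt_pi hψ₁ (by linarith [pi_pos])
  have hconv := convex_setOf_lt_log_sin_div hψ
  set Λ := {p : ℝ × ℝ | -ψ < p.1 ∧ p.1 < π - ψ ∧ p.2 < log (sin (p.1 + ψ) / sin ψ)}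
  have hb : ∀ p ∈ Λ, 0 < sin (p.1 + ψ) := fun p hp =>
    sin_pos_of_pos_of_lt_pi (by linarith [hp.1]) (by linarith [hp.2.1])
  have hG : ∀ p ∈ Λ, 0 < sin (p.1 + ψ) - sin ψ * exp p.2 := fun p hp =>
    sub_pos.2 (exp_mul_sin_lt_of_lt_log hψ (hb p hp) hp.2.2)
  have hN : ∀ p ∈ Λ, 0 < exp p.2 * sin (p.1 - ψ) + sin ψ := fun p hp =>
    exp_mul_sin_sub_add_sin_pos hψ (sub_pos.1 (hG p hp))
  have hD (p : ℝ × ℝ) : exp (-p.2) * sin (p.1 + ψ) - sin ψ =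
      exp (-p.2) * (sin (p.1 + ψ) - sin ψ * exp p.2) := by
    have : exp (-p.2) * exp p.2 = 1 := by rw [← exp_add]; simp
    linear_combination sin ψ * this
  have hK : ∀ p ∈ Λ, log ((exp p.2 * sin (p.1 - ψ) + sin ψ) /
      (exp (-p.2) * sin (p.1 + ψ) - sin ψ)) =
      log (exp p.2 * sin (p.1 - ψ) + sin ψ) - log (sin (p.1 + ψ) - sin ψ * exp p.2) + p.2 := by
    intro p hp
    rw [hD, log_div (hN p hp).ne' (mul_pos (exp_pos _) (hG p hp)).ne',
      log_mul (exp_pos _).ne' (hG p hp).ne', log_exp]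
    ring
  refine ⟨hconv, fun p hp => ⟨hN p hp, hD p ▸ mul_pos (exp_pos _) (hG p hp)⟩, ?_⟩
  have hsnd : ConvexOn ℝ Λ (fun p => p.2) := (LinearMap.snd ℝ ℝ ℝ).convexOn hconv
  exact ((convexOn_log_sub_log hψ hconv hb hN hG).add hsnd).congr fun p hp => (hK p hp).symm
end
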